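/- Let H be a Hopf algebra, K and S left H-comodule algebras, and P a (K,S)-bimodule with a left H-comodule structure compatible with both actions (P ∈ _K^H M_S). For a finite-dimensional left H-module X, the tensor product X ⊗ S with left S-action s·(x ⊗ t) = s₍₋₁₎·x ⊗ s₍₀₎t is a left S-module, and if (H,R) is quasi-triangular, then P ⊗_S (X ⊗ S) with coaction δ(p ⊗ x ⊗ s) = p₍₋₁₎R²s₍₋₁₎ ⊗ p₍₀₎ ⊗ R¹·x ⊗ s₍₀₎, left K-action r·(p⊗x⊗s) = r·p ⊗ x ⊗ s, and right S-action (p⊗x⊗s)·l = p ⊗ x ⊗ sl, is again an object of _K^H M_S. -/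

import Mathlib

/-!
STATEMENT 9: Let (H,R) be quasi-triangular, K, S left H-comodule algebras, P ∈ _K^H M_S and
X a (finite-dimensional) H-module.  Then X ⊗ S with s·(x⊗t) = s₍₋₁₎·x ⊗ s₍₀₎t is a left
S-module, and P ⊗_S (X ⊗ S) with δ(p⊗x⊗s) = p₍₋₁₎R²s₍₋₁₎ ⊗ p₍₀₎ ⊗ R¹·x ⊗ s₍₀₎,
r·(p⊗x⊗s) = r·p⊗x⊗s, (p⊗x⊗s)·l = p⊗x⊗sl is again an object of _K^H M_S (all structure
maps descend to the quotient by the balancing submodule N, and the axioms hold modulo N).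
-/

open TensorProduct

noncomputable section

variable (k : Type) [Field k] (H : Type) [Ring H] [HopfAlgebra k H]

/-- The action of `H` on an `H`-module `X`, as a linear map `H ⊗ X → X`. -/
def hact (X : Type) [AddCommGroup X] [Module k X] [Module H X]
    [IsScalarTower k H X] [SMulCommClass H k X] [SMulCommClass k H X] :
    H ⊗[k] X →ₗ[k] X :=
  TensorProduct.lift ((Algebra.lsmul k k X : H →ₐ[k] Module.End k X).toLinearMap)

variable (S : Type) [Ring S] [Algebra k S] (lamS : S →ₗ[k] H ⊗[k] S)

/-- The left `S`-action on `X ⊗ S` : `s · (x ⊗ t) = s₍₋₁₎ · x ⊗ s₍₀₎ t`. -/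
def leftActXS (X : Type) [AddCommGroup X] [Module k X] [Module H X]
    [IsScalarTower k H X] [SMulCommClass H k X] [SMulCommClass k H X] (s : S) :
    X ⊗[k] S →ₗ[k] X ⊗[k] S :=
  (TensorProduct.map (hact k H X) (LinearMap.mul' k S)) ∘ₗ
    (TensorProduct.tensorTensorTensorComm k H S X S).toLinearMap ∘ₗ
    (TensorProduct.mk k (H ⊗[k] S) (X ⊗[k] S) (lamS s))

/-- The rearrangement `X ⊗ (H ⊗ S) → H ⊗ (X ⊗ S)`. -/
def e2lin (X : Type) [AddCommGroup X] [Module k X] :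
    X ⊗[k] (H ⊗[k] S) →ₗ[k] H ⊗[k] (X ⊗[k] S) :=
  (TensorProduct.assoc k H X S).toLinearMap ∘ₗ
    (LinearMap.rTensor S (TensorProduct.comm k X H).toLinearMap) ∘ₗ
    (TensorProduct.assoc k X H S).symm.toLinearMap

variable (K : Type) [Ring K] [Algebra k K] (lamK : K →ₗ[k] H ⊗[k] K)

/-- Assembling map computing `k₍₋₁₎ m₍₋₁₎ s₍₋₁₎ ⊗ k₍₀₎ · m₍₀₎ · s₍₀₎` from
`(k₍₋₁₎ ⊗ k₍₀₎) ⊗ ((m₍₋₁₎ ⊗ m₍₀₎) ⊗ (s₍₋₁₎ ⊗ s₍₀₎))`, given linearized left `K`- and right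
`S`-actions on a module `M`. -/
def sandwich (M : Type) [AddCommGroup M] [Module k M]
    (kactLin : K →ₗ[k] M →ₗ[k] M) (sactLin : S →ₗ[k] M →ₗ[k] M) :
    (H ⊗[k] K) ⊗[k] ((H ⊗[k] M) ⊗[k] (H ⊗[k] S)) →ₗ[k] H ⊗[k] M :=
  ((TensorProduct.map (LinearMap.mul' k H) (TensorProduct.lift kactLin)) ∘ₗ
      (TensorProduct.tensorTensorTensorComm k H K H M).toLinearMap) ∘ₗ
    LinearMap.lTensor (H ⊗[k] K)
      ((TensorProduct.map (LinearMap.mul' k H) (TensorProduct.lift (sactLin.flip))) ∘ₗ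
        (TensorProduct.tensorTensorTensorComm k H M H S).toLinearMap)

variable (P : Type) [AddCommGroup P] [Module k P]
  [Module K P] [IsScalarTower k K P] [SMulCommClass K k P] [SMulCommClass k K P]
  [Module Sᵐᵒᵖ P] [IsScalarTower k Sᵐᵒᵖ P] [SMulCommClass Sᵐᵒᵖ k P] [SMulCommClass k Sᵐᵒᵖ P]
  [SMulCommClass K Sᵐᵒᵖ P]

/-- The right `S`-action on `P` linearized, `S →ₗ (P →ₗ P)`. -/
def sactLinP : S →ₗ[k] P →ₗ[k] P :=
  ((Algebra.lsmul k k P : Sᵐᵒᵖ →ₐ[k] Module.End k P).toLinearMap) ∘ₗ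
    (MulOpposite.opLinearEquiv k : S ≃ₗ[k] Sᵐᵒᵖ).toLinearMap

/-- The left `K`-action on `P` linearized, `K →ₗ (P →ₗ P)`. -/
def kactLinP : K →ₗ[k] P →ₗ[k] P :=
  (Algebra.lsmul k k P : K →ₐ[k] Module.End k P).toLinearMap

/-- The coaction `δ` of `H` on `W = P ⊗ (X ⊗ S)`:
`δ(p ⊗ x ⊗ s) = p₍₋₁₎ R² s₍₋₁₎ ⊗ p₍₀₎ ⊗ R¹ · x ⊗ s₍₀₎`. -/
def deltaW (R : H ⊗[k] H) (lamP : P →ₗ[k] H ⊗[k] P)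
    (X : Type) [AddCommGroup X] [Module k X] [Module H X]
    [IsScalarTower k H X] [SMulCommClass H k X] [SMulCommClass k H X] :
    P ⊗[k] (X ⊗[k] S) →ₗ[k] H ⊗[k] (P ⊗[k] (X ⊗[k] S)) :=
  (TensorProduct.map (LinearMap.mul' k H) LinearMap.id) ∘ₗ
  (TensorProduct.tensorTensorTensorComm k H P H (X ⊗[k] S)).toLinearMap ∘ₗ
  (LinearMap.lTensor (H ⊗[k] P) (e2lin k H S X)) ∘ₗ
  (LinearMap.lTensor (H ⊗[k] P)
    (TensorProduct.map (hact k H X) (LinearMap.id (M := H ⊗[k] S)))) ∘ₗ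
  (LinearMap.lTensor (H ⊗[k] P)
    ((TensorProduct.tensorTensorTensorComm k H H X S).toLinearMap ∘ₗ
      (LinearMap.rTensor (X ⊗[k] S) (TensorProduct.comm k H H).toLinearMap))) ∘ₗ
  (TensorProduct.tensorTensorTensorComm k H (H ⊗[k] H) P (X ⊗[k] S)).toLinearMap ∘ₗ
  (LinearMap.rTensor (P ⊗[k] (X ⊗[k] S))
    -- (r1 ⊗ r2) ⊗ (h ⊗ h') ↦ (h * r2) ⊗ (h' ⊗ r1)
    ((TensorProduct.map (LinearMap.mul' k H) LinearMap.id) ∘ₗ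
      (TensorProduct.tensorTensorTensorComm k H H H H).toLinearMap ∘ₗ
      (TensorProduct.comm k (H ⊗[k] H) (H ⊗[k] H)).toLinearMap ∘ₗ
      (LinearMap.rTensor (H ⊗[k] H) (TensorProduct.comm k H H).toLinearMap))) ∘ₗ
  (TensorProduct.assoc k (H ⊗[k] H) (H ⊗[k] H) (P ⊗[k] (X ⊗[k] S))).symm.toLinearMap ∘ₗ
  (TensorProduct.mk k (H ⊗[k] H) ((H ⊗[k] H) ⊗[k] (P ⊗[k] (X ⊗[k] S))) R) ∘ₗ
  (TensorProduct.tensorTensorTensorComm k H P H (X ⊗[k] S)).toLinearMap ∘ₗ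
  (LinearMap.lTensor (H ⊗[k] P) (e2lin k H S X)) ∘ₗ
  (TensorProduct.map lamP (LinearMap.lTensor X lamS))

/-- Generic core of the coaction: `(r ⊗ a) ((b ⊗ p) (x ⊗ (c ⊗ s))) ↦ b a c ⊗ p ⊗ r x ⊗ s`,
for an arbitrary coefficient algebra `A`. -/
def coreMap (A : Type) [Ring A] [Algebra k A] (P : Type) [AddCommGroup P] [Module k P]
    (X : Type) [AddCommGroup X] [Module k X] [Module H X]
    [IsScalarTower k H X] [SMulCommClass H k X] [SMulCommClass k H X] :
    (H ⊗[k] A) ⊗[k] ((A ⊗[k] P) ⊗[k] (X ⊗[k] (A ⊗[k] S))) →ₗ[k] A ⊗[k] (P ⊗[k] (X ⊗[k] S)) :=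
  (TensorProduct.map (LinearMap.mul' k A) LinearMap.id) ∘ₗ
  (TensorProduct.tensorTensorTensorComm k A P A (X ⊗[k] S)).toLinearMap ∘ₗ
  (LinearMap.lTensor (A ⊗[k] P)
    ((TensorProduct.map (LinearMap.mul' k A)
        (LinearMap.rTensor S (hact k H X) ∘ₗ (TensorProduct.assoc k H X S).symm.toLinearMap)) ∘ₗ
    (TensorProduct.tensorTensorTensorComm k A H A (X ⊗[k] S)).toLinearMap ∘ₗ
    (TensorProduct.map (TensorProduct.comm k H A).toLinearMap
      (TensorProduct.leftComm k X A S).toLinearMap))) ∘ₗ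
  (TensorProduct.leftComm k (H ⊗[k] A) (A ⊗[k] P) (X ⊗[k] (A ⊗[k] S))).toLinearMap

section helpers

variable (X : Type) [AddCommGroup X] [Module k X] [Module H X]
    [IsScalarTower k H X] [SMulCommClass H k X] [SMulCommClass k H X]

lemma hact_tmul (h : H) (x : X) : hact k H X (h ⊗ₜ x) = h • x := rfl

lemma e2lin_tmul (x : X) (h : H) (s : S) :
    e2lin k H S X (x ⊗ₜ (h ⊗ₜ s)) = h ⊗ₜ (x ⊗ₜ s) := rfl

lemma coreMap_tmul (A : Type) [Ring A] [Algebra k A] (r : H) (a b c : A) (p : P) (x : X) (s : S) :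
    coreMap k H S A P X ((r ⊗ₜ a) ⊗ₜ ((b ⊗ₜ p) ⊗ₜ (x ⊗ₜ (c ⊗ₜ s)))) =
      (b * a * c) ⊗ₜ (p ⊗ₜ ((r • x) ⊗ₜ s)) := by
  simp [coreMap, hact_tmul, mul_assoc]

lemma deltaW_eq (R : H ⊗[k] H) (lamP : P →ₗ[k] H ⊗[k] P) (p : P) (x : X) (s : S) :
    deltaW k H S lamS P R lamP X (p ⊗ₜ (x ⊗ₜ s)) =
      coreMap k H S H P X (R ⊗ₜ (lamP p ⊗ₜ (x ⊗ₜ lamS s))) := by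
  simp only [deltaW, LinearMap.comp_apply, TensorProduct.map_tmul, LinearMap.lTensor_tmul]
  generalize lamP p = a
  generalize lamS s = b
  induction R using TensorProduct.induction_on with
  | zero => simp
  | add _ _ h1 h2 =>
    simp only [map_add, add_tmul, LinearMap.add_apply] at h1 h2 ⊢
    rw [h1, h2]
  | tmul r1 r2 =>
  induction a using TensorProduct.induction_on with
  | zero => simp
  | add _ _ h1 h2 => simp only [map_add, add_tmul, tmul_add] at h1 h2 ⊢; rw [h1, h2]
  | tmul h p =>
  induction b using TensorProduct.induction_on with
  | zero => simp
  | add _ _ h1 h2 => simp only [map_add, tmul_add] at h1 h2 ⊢; rw [h1, h2]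
  | tmul g s => simp [coreMap_tmul, e2lin_tmul, hact_tmul]

/-- Naturality of `coreMap` in the coefficient algebra. -/
lemma coreMap_natural (A B : Type) [Ring A] [Algebra k A] [Ring B] [Algebra k B] (f : A →ₐ[k] B)
    (R : H ⊗[k] A) (a : A ⊗[k] P) (x : X) (b : A ⊗[k] S) :
    LinearMap.rTensor (P ⊗[k] (X ⊗[k] S)) f.toLinearMap
      (coreMap k H S A P X (R ⊗ₜ (a ⊗ₜ (x ⊗ₜ b)))) =
    coreMap k H S B P X (LinearMap.lTensor H f.toLinearMap R ⊗ₜ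
      (LinearMap.rTensor P f.toLinearMap a ⊗ₜ (x ⊗ₜ LinearMap.rTensor S f.toLinearMap b))) := by
  induction R using TensorProduct.induction_on with
  | zero => simp
  | add _ _ h1 h2 => simp only [map_add, add_tmul] at h1 h2 ⊢; rw [h1, h2]
  | tmul r1 r2 =>
  induction a using TensorProduct.induction_on with
  | zero => simp
  | add _ _ h1 h2 => simp only [map_add, add_tmul, tmul_add] at h1 h2 ⊢; rw [h1, h2]
  | tmul h p =>
  induction b using TensorProduct.induction_on with
  | zero => simp
  | add _ _ h1 h2 => simp only [map_add, tmul_add] at h1 h2 ⊢; rw [h1, h2]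
  | tmul g s => simp [coreMap_tmul]

/-- `R₁₃ * Q₁₂`. -/
abbrev prodR (R Q : H ⊗[k] H) : (H ⊗[k] H) ⊗[k] H :=
  (Algebra.TensorProduct.map
    (Algebra.TensorProduct.includeLeft : H →ₐ[k] H ⊗[k] H) (AlgHom.id k H)) R *
  (Algebra.TensorProduct.includeLeft : (H ⊗[k] H) →ₐ[k] (H ⊗[k] H) ⊗[k] H) Q

lemma coreMap_iter_aux (Q : H ⊗[k] H) (r1 r2 h g : H) (a : H ⊗[k] P) (x : X) (b : H ⊗[k] S) :
    (h * r2 * g) ⊗ₜ[k] (coreMap k H S H P X (Q ⊗ₜ (a ⊗ₜ ((r1 • x) ⊗ₜ b)))) =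
    TensorProduct.assoc k H H _ (coreMap k H S (H ⊗[k] H) P X
      (TensorProduct.assoc k H H H (prodR k H Q (r1 ⊗ₜ r2)) ⊗ₜ
        ((TensorProduct.assoc k H H P).symm (h ⊗ₜ a) ⊗ₜ
          (x ⊗ₜ (TensorProduct.assoc k H H S).symm (g ⊗ₜ b))))) := by
  induction Q using TensorProduct.induction_on with
  | zero => simp [prodR]
  | add _ _ h1 h2 =>
    simp only [prodR, map_add, add_tmul, tmul_add, add_mul] at h1 h2 ⊢; rw [h1, h2]
  | tmul q1 q2 =>
  induction a using TensorProduct.induction_on with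
  | zero => simp
  | add _ _ h1 h2 => simp only [map_add, add_tmul, tmul_add] at h1 h2 ⊢; rw [h1, h2]
  | tmul h p =>
  induction b using TensorProduct.induction_on with
  | zero => simp
  | add _ _ h1 h2 => simp only [map_add, tmul_add] at h1 h2 ⊢; rw [h1, h2]
  | tmul g s => simp [coreMap_tmul, prodR, mul_smul]

lemma coreMap_iter (lamP : P →ₗ[k] H ⊗[k] P) (Q R : H ⊗[k] H) (a : H ⊗[k] P) (x : X)
    (b : H ⊗[k] S) :
    LinearMap.lTensor H (deltaW k H S lamS P Q lamP X)
      (coreMap k H S H P X (R ⊗ₜ (a ⊗ₜ (x ⊗ₜ b)))) =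
    TensorProduct.assoc k H H _ (coreMap k H S (H ⊗[k] H) P X
      (TensorProduct.assoc k H H H (prodR k H Q R) ⊗ₜ
        ((TensorProduct.assoc k H H P).symm (LinearMap.lTensor H lamP a) ⊗ₜ
          (x ⊗ₜ (TensorProduct.assoc k H H S).symm (LinearMap.lTensor H lamS b))))) := by
  induction R using TensorProduct.induction_on with
  | zero => simp [prodR]
  | add _ _ h1 h2 =>
    simp only [prodR, map_add, add_tmul, mul_add] at h1 h2 ⊢; rw [h1, h2]
  | tmul r1 r2 =>
  induction a using TensorProduct.induction_on with
  | zero => simp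
  | add _ _ h1 h2 => simp only [map_add, add_tmul, tmul_add] at h1 h2 ⊢; rw [h1, h2]
  | tmul h p =>
  induction b using TensorProduct.induction_on with
  | zero => simp
  | add _ _ h1 h2 => simp only [map_add, tmul_add] at h1 h2 ⊢; rw [h1, h2]
  | tmul g s =>
    rw [coreMap_tmul, LinearMap.lTensor_tmul, deltaW_eq, coreMap_iter_aux]
    simp only [LinearMap.lTensor_tmul]

/-- `(id ⊗ ε) R = 1`. -/
lemma counit_R (R : H ⊗[k] H) (hR : IsUnit R)
    (hR2 : (TensorProduct.map (LinearMap.id (M := H)) (Coalgebra.comul (R := k))) R =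
      (TensorProduct.assoc k H H H) (prodR k H R R)) :
    LinearMap.lTensor H (Coalgebra.counit (R := k) (A := H)) R = 1 ⊗ₜ 1 := by
  -- apply `id ⊗ (ε ⊗ id)`
  have e1 : ∀ Q : H ⊗[k] H, LinearMap.lTensor H ((TensorProduct.lid k H).toLinearMap ∘ₗ
      LinearMap.rTensor H (Coalgebra.counit (R := k) (A := H)))
      ((TensorProduct.map (LinearMap.id (M := H)) (Coalgebra.comul (R := k))) Q) = Q := by
    intro Q
    induction Q using TensorProduct.induction_on with
    | zero => simp
    | add _ _ h1 h2 => simp only [map_add, h1, h2]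
    | tmul a b => simp
  have e2 : ∀ Q R : H ⊗[k] H, LinearMap.lTensor H ((TensorProduct.lid k H).toLinearMap ∘ₗ
      LinearMap.rTensor H (Coalgebra.counit (R := k) (A := H)))
      ((TensorProduct.assoc k H H H) (prodR k H Q R)) =
      Q * ((TensorProduct.rid k H (LinearMap.lTensor H (Coalgebra.counit (R := k) (A := H)) R))
        ⊗ₜ 1) := by
    intro Q R
    induction Q using TensorProduct.induction_on with
    | zero => simp [prodR]
    | add _ _ h1 h2 => simp only [prodR, map_add, add_mul] at h1 h2 ⊢; rw [h1, h2]
    | tmul a b =>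
    induction R using TensorProduct.induction_on with
    | zero => simp [prodR]
    | add _ _ h1 h2 => simp only [prodR, map_add, mul_add, add_tmul] at h1 h2 ⊢; rw [h1, h2]
    | tmul c d => simp [prodR, tmul_smul, smul_tmul']
  have h := e1 R
  rw [hR2, e2] at h
  have h1 := hR.mul_left_cancel (h.trans (mul_one R).symm)
  have h2 := congrArg (fun z => TensorProduct.rid k H
    (LinearMap.lTensor H (Coalgebra.counit (R := k) (A := H)) z)) h1
  simp only [Algebra.TensorProduct.one_def, LinearMap.lTensor_tmul, Bialgebra.counit_one,
    TensorProduct.rid_tmul, one_smul] at h2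
  apply (TensorProduct.rid k H).injective
  simpa using h2

/-- The linearized left action `(H ⊗ S) ⊗ (X ⊗ S) → X ⊗ S`. -/
def LMap : (H ⊗[k] S) ⊗[k] (X ⊗[k] S) →ₗ[k] X ⊗[k] S :=
  (TensorProduct.map (hact k H X) (LinearMap.mul' k S)) ∘ₗ
    (TensorProduct.tensorTensorTensorComm k H S X S).toLinearMap

lemma LMap_tmul (h : H) (s t : S) (x : X) :
    LMap k H S X ((h ⊗ₜ s) ⊗ₜ (x ⊗ₜ t)) = (h • x) ⊗ₜ (s * t) := rfl

lemma leftAct_eq (s : S) (v : X ⊗[k] S) :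
    leftActXS k H S lamS X s v = LMap k H S X (lamS s ⊗ₜ v) := rfl

lemma LMap_mul (a b : H ⊗[k] S) (v : X ⊗[k] S) :
    LMap k H S X ((a * b) ⊗ₜ v) = LMap k H S X (a ⊗ₜ LMap k H S X (b ⊗ₜ v)) := by
  induction a using TensorProduct.induction_on with
  | zero => simp
  | add _ _ h1 h2 => simp only [map_add, add_tmul, add_mul, h1, h2]
  | tmul h p =>
  induction b using TensorProduct.induction_on with
  | zero => simp
  | add _ _ h1 h2 => simp only [map_add, add_tmul, tmul_add, mul_add, h1, h2]
  | tmul g s =>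
  induction v using TensorProduct.induction_on with
  | zero => simp
  | add _ _ h1 h2 => simp only [map_add, tmul_add, h1, h2]
  | tmul x t => simp [LMap_tmul, mul_smul, mul_assoc]

lemma LMap_one (v : X ⊗[k] S) : LMap k H S X (1 ⊗ₜ v) = v := by
  induction v using TensorProduct.induction_on with
  | zero => simp
  | add _ _ h1 h2 => simp only [map_add, tmul_add, h1, h2]
  | tmul x t => rw [Algebra.TensorProduct.one_def, LMap_tmul, one_smul, one_mul]

lemma LMap_right (a : H ⊗[k] S) (v : X ⊗[k] S) (l : S) :
    LinearMap.lTensor X ((LinearMap.mul k S).flip l) (LMap k H S X (a ⊗ₜ v)) =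
      LMap k H S X (a ⊗ₜ LinearMap.lTensor X ((LinearMap.mul k S).flip l) v) := by
  induction a using TensorProduct.induction_on with
  | zero => simp
  | add _ _ h1 h2 => simp only [map_add, add_tmul, h1, h2]
  | tmul h p =>
  induction v using TensorProduct.induction_on with
  | zero => simp
  | add _ _ h1 h2 => simp only [map_add, tmul_add, h1, h2]
  | tmul x t => simp [LMap_tmul, mul_assoc]

/-- `U ⊗ t ↦ core (φ U) a x ((1 ⊗ t) b)`, on `H ⊗ (H ⊗ S)`. -/
def ZMap (φ : H ⊗[k] H →ₗ[k] H ⊗[k] H) (a : H ⊗[k] P) (x : X) (b : H ⊗[k] S) :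
    H ⊗[k] (H ⊗[k] S) →ₗ[k] H ⊗[k] (P ⊗[k] (X ⊗[k] S)) :=
  coreMap k H S H P X ∘ₗ
    TensorProduct.map φ
      (TensorProduct.mk k (H ⊗[k] P) (X ⊗[k] (H ⊗[k] S)) a ∘ₗ
        TensorProduct.mk k X (H ⊗[k] S) x ∘ₗ
        LinearMap.mulRight k b ∘ₗ
        (Algebra.TensorProduct.includeRight : S →ₐ[k] H ⊗[k] S).toLinearMap) ∘ₗ
    (TensorProduct.assoc k H H S).symm.toLinearMap

lemma ZMap_assoc (φ : H ⊗[k] H →ₗ[k] H ⊗[k] H) (a : H ⊗[k] P) (x : X) (b : H ⊗[k] S)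
    (U : H ⊗[k] H) (t : S) :
    ZMap k H S P X φ a x b (TensorProduct.assoc k H H S (U ⊗ₜ t)) =
      coreMap k H S H P X (φ U ⊗ₜ (a ⊗ₜ (x ⊗ₜ ((1 ⊗ₜ t) * b)))) := by
  simp [ZMap]

lemma ZMap_tmul (φ : H ⊗[k] H →ₗ[k] H ⊗[k] H) (a : H ⊗[k] P) (x : X) (b : H ⊗[k] S)
    (g h : H) (t : S) :
    ZMap k H S P X φ a x b (g ⊗ₜ (h ⊗ₜ t)) =
      coreMap k H S H P X (φ (g ⊗ₜ h) ⊗ₜ (a ⊗ₜ (x ⊗ₜ ((1 ⊗ₜ t) * b)))) := by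
  simp [ZMap]

/-- quasi-triangularity consequence -/
lemma ZMap_swap (R : H ⊗[k] H)
    (hR3 : ∀ h : H, R * Coalgebra.comul (R := k) h =
      (TensorProduct.comm k H H) (Coalgebra.comul (R := k) h) * R)
    (a : H ⊗[k] P) (x : X) (b c : H ⊗[k] S) :
    ZMap k H S P X (LinearMap.mulRight k R ∘ₗ (TensorProduct.comm k H H).toLinearMap) a x b
      (TensorProduct.assoc k H H S (LinearMap.rTensor S (Coalgebra.comul (R := k)) c)) =
    ZMap k H S P X (LinearMap.mulLeft k R) a x b
      (TensorProduct.assoc k H H S (LinearMap.rTensor S (Coalgebra.comul (R := k)) c)) := by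
  induction c using TensorProduct.induction_on with
  | zero => simp
  | add _ _ h1 h2 => simp only [map_add, h1, h2]
  | tmul h t =>
    rw [LinearMap.rTensor_tmul, ZMap_assoc, ZMap_assoc]
    simp [hR3]

/-- Right multiplication `(H ⊗ P) ⊗ (H ⊗ S) → H ⊗ P`. -/
def mPMap : (H ⊗[k] P) ⊗[k] (H ⊗[k] S) →ₗ[k] H ⊗[k] P :=
  (TensorProduct.map (LinearMap.mul' k H) (TensorProduct.lift ((sactLinP k S P).flip))) ∘ₗ
        (TensorProduct.tensorTensorTensorComm k H P H S).toLinearMap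

lemma mPMap_tmul (h g : H) (p : P) (s : S) :
    mPMap k H S P ((h ⊗ₜ p) ⊗ₜ (g ⊗ₜ s)) = (h * g) ⊗ₜ (MulOpposite.op s • p) := rfl

lemma delta_leftAct (hmulS : ∀ a b : S, lamS (a * b) = lamS a * lamS b)
    (lamP : P →ₗ[k] H ⊗[k] P) (R : H ⊗[k] H) (p : P) (c : H ⊗[k] S) (x : X) (s : S) :
    deltaW k H S lamS P R lamP X (p ⊗ₜ LMap k H S X (c ⊗ₜ (x ⊗ₜ s))) =
    ZMap k H S P X (LinearMap.mulLeft k R) (lamP p) x (lamS s) (LinearMap.lTensor H lamS c) := by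
  induction c using TensorProduct.induction_on with
  | zero => simp
  | add _ _ h1 h2 => simp only [map_add, add_tmul, tmul_add, h1, h2]
  | tmul g t =>
    rw [LMap_tmul, deltaW_eq, hmulS, LinearMap.lTensor_tmul]
    generalize lamP p = a
    generalize lamS s = b
    generalize lamS t = d
    induction d using TensorProduct.induction_on with
    | zero => simp
    | add _ _ h1 h2 => simp only [map_add, add_tmul, tmul_add, add_mul, h1, h2]
    | tmul g' t' =>
    rw [ZMap_tmul]
    induction R using TensorProduct.induction_on with
    | zero => simp
    | add _ _ h1 h2 =>
      simp only [map_add, add_tmul, LinearMap.mulLeft_apply, add_mul] at h1 h2 ⊢; rw [h1, h2]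
    | tmul r1 r2 =>
    induction a using TensorProduct.induction_on with
    | zero => simp
    | add _ _ h1 h2 => simp only [map_add, add_tmul, tmul_add] at h1 h2 ⊢; rw [h1, h2]
    | tmul h p =>
    induction b using TensorProduct.induction_on with
    | zero => simp
    | add _ _ h1 h2 => simp only [map_add, tmul_add, mul_add] at h1 h2 ⊢; rw [h1, h2]
    | tmul f s => simp [coreMap_tmul, mul_smul, mul_assoc]

lemma delta_rightAct (N : Submodule k (P ⊗[k] (X ⊗[k] S)))
    (hN : ∀ (p : P) (s : S) (v : X ⊗[k] S),
      (MulOpposite.op s • p) ⊗ₜ v - p ⊗ₜ (leftActXS k H S lamS X s v) ∈ N)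
    (R : H ⊗[k] H) (a : H ⊗[k] P) (x : X) (b c : H ⊗[k] S) :
    LinearMap.lTensor H N.mkQ
      (coreMap k H S H P X (R ⊗ₜ (mPMap k H S P (a ⊗ₜ c) ⊗ₜ (x ⊗ₜ b)))) =
    LinearMap.lTensor H N.mkQ
      (ZMap k H S P X (LinearMap.mulRight k R ∘ₗ (TensorProduct.comm k H H).toLinearMap) a x b
        (LinearMap.lTensor H lamS c)) := by
  induction c using TensorProduct.induction_on with
  | zero => simp
  | add _ _ h1 h2 => simp only [map_add, add_tmul, tmul_add, h1, h2]
  | tmul g t =>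
    rw [LinearMap.lTensor_tmul]
    have key : ∀ (r1 r2 h f : H) (p : P) (s : S) (d : H ⊗[k] S),
        ZMap k H S P X (LinearMap.mulRight k (r1 ⊗ₜ r2) ∘ₗ (TensorProduct.comm k H H).toLinearMap)
          (h ⊗ₜ p) x (f ⊗ₜ s) (g ⊗ₜ d) =
        (h * g * r2 * f) ⊗ₜ (p ⊗ₜ LMap k H S X (d ⊗ₜ ((r1 • x) ⊗ₜ s))) := by
      intro r1 r2 h f p s d
      induction d using TensorProduct.induction_on with
      | zero => simp
      | add _ _ h1 h2 => simp only [map_add, add_tmul, tmul_add, h1, h2]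
      | tmul g' t' =>
        rw [ZMap_tmul]
        simp [coreMap_tmul, LMap_tmul, mul_smul, mul_assoc]
    -- make additivity of ZMap in its parameters visible
    have haddR : ∀ (R R' : H ⊗[k] H) (a : H ⊗[k] P) (b : H ⊗[k] S) (d : H ⊗[k] (H ⊗[k] S)),
        ZMap k H S P X (LinearMap.mulRight k (R + R') ∘ₗ (TensorProduct.comm k H H).toLinearMap)
          a x b d = ZMap k H S P X (LinearMap.mulRight k R ∘ₗ
            (TensorProduct.comm k H H).toLinearMap) a x b d +
          ZMap k H S P X (LinearMap.mulRight k R' ∘ₗ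
            (TensorProduct.comm k H H).toLinearMap) a x b d := by
      intro R R' a b d
      obtain ⟨d, rfl⟩ := (TensorProduct.assoc k H H S).surjective d
      induction d using TensorProduct.induction_on with
      | zero => simp
      | add _ _ h1 h2 => simp only [map_add, h1, h2]; abel
      | tmul U t => simp only [ZMap_assoc]; simp [mul_add, add_tmul]
    have hadda : ∀ (φ : H ⊗[k] H →ₗ[k] H ⊗[k] H) (a a' : H ⊗[k] P) (b : H ⊗[k] S)
        (d : H ⊗[k] (H ⊗[k] S)),
        ZMap k H S P X φ (a + a') x b d = ZMap k H S P X φ a x b d +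
          ZMap k H S P X φ a' x b d := by
      intro φ a a' b d
      obtain ⟨d, rfl⟩ := (TensorProduct.assoc k H H S).surjective d
      induction d using TensorProduct.induction_on with
      | zero => simp
      | add _ _ h1 h2 => simp only [map_add, h1, h2]; abel
      | tmul U t => simp only [ZMap_assoc]; simp [add_tmul, tmul_add]
    have haddb : ∀ (φ : H ⊗[k] H →ₗ[k] H ⊗[k] H) (a : H ⊗[k] P) (b b' : H ⊗[k] S)
        (d : H ⊗[k] (H ⊗[k] S)),
        ZMap k H S P X φ a x (b + b') d = ZMap k H S P X φ a x b d +
          ZMap k H S P X φ a x b' d := by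
      intro φ a b b' d
      obtain ⟨d, rfl⟩ := (TensorProduct.assoc k H H S).surjective d
      induction d using TensorProduct.induction_on with
      | zero => simp
      | add _ _ h1 h2 => simp only [map_add, h1, h2]; abel
      | tmul U t => simp only [ZMap_assoc]; simp [mul_add, tmul_add]
    induction R using TensorProduct.induction_on with
    | zero => simp [ZMap]
    | add _ _ h1 h2 =>
      rw [haddR]
      simp only [map_add, add_tmul] at h1 h2 ⊢; rw [h1, h2]
    | tmul r1 r2 =>
    induction a using TensorProduct.induction_on with
    | zero => simp [ZMap]
    | add _ _ h1 h2 =>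
      rw [hadda]
      simp only [map_add, add_tmul, tmul_add] at h1 h2 ⊢; rw [h1, h2]
    | tmul h p =>
    induction b using TensorProduct.induction_on with
    | zero => simp [ZMap]
    | add _ _ h1 h2 =>
      rw [haddb]
      simp only [map_add, tmul_add] at h1 h2 ⊢; rw [h1, h2]
    | tmul f s =>
      rw [key, mPMap_tmul, coreMap_tmul, LinearMap.lTensor_tmul, LinearMap.lTensor_tmul]
      congr 1
      exact (Submodule.Quotient.eq N).2 (hN p t ((r1 • x) ⊗ₜ s))

lemma sandwich_one_left (a : H ⊗[k] P) (c : H ⊗[k] S) :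
    sandwich k H S K P (kactLinP k K P) (sactLinP k S P) ((1 : H ⊗[k] K) ⊗ₜ (a ⊗ₜ c)) =
      mPMap k H S P (a ⊗ₜ c) := by
  change ((TensorProduct.map (LinearMap.mul' k H) (TensorProduct.lift (kactLinP k K P))) ∘ₗ
      (TensorProduct.tensorTensorTensorComm k H K H P).toLinearMap)
        ((1 : H ⊗[k] K) ⊗ₜ (mPMap k H S P (a ⊗ₜ c))) = _
  generalize mPMap k H S P (a ⊗ₜ c) = z
  induction z using TensorProduct.induction_on with
  | zero => simp
  | add _ _ h1 h2 => simp only [map_add, tmul_add, h1, h2]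
  | tmul h p => simp [Algebra.TensorProduct.one_def, kactLinP]

lemma coreMap_bimod (R : H ⊗[k] H) (d : H ⊗[k] K) (a : H ⊗[k] P) (x : X) (b c : H ⊗[k] S) :
    coreMap k H S H P X (R ⊗ₜ
      (sandwich k H S K P (kactLinP k K P) (sactLinP k S P) (d ⊗ₜ (a ⊗ₜ (1 : H ⊗[k] S))) ⊗ₜ
        (x ⊗ₜ (b * c)))) =
    sandwich k H S K (P ⊗[k] (X ⊗[k] S))
      ((LinearMap.rTensorHom (M := X ⊗[k] S)) ∘ₗ
        (Algebra.lsmul k k P : K →ₐ[k] Module.End k P).toLinearMap)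
      ((LinearMap.lTensorHom (M := P)) ∘ₗ (LinearMap.lTensorHom (M := X)) ∘ₗ
        (LinearMap.mul k S).flip)
      (d ⊗ₜ (coreMap k H S H P X (R ⊗ₜ (a ⊗ₜ (x ⊗ₜ b))) ⊗ₜ c)) := by
  induction R using TensorProduct.induction_on with
  | zero => simp
  | add _ _ h1 h2 => simp only [map_add, add_tmul, tmul_add] at h1 h2 ⊢; rw [h1, h2]
  | tmul r1 r2 =>
  induction d using TensorProduct.induction_on with
  | zero => simp
  | add _ _ h1 h2 => simp only [map_add, add_tmul, tmul_add] at h1 h2 ⊢; rw [h1, h2]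
  | tmul h0 r =>
  induction a using TensorProduct.induction_on with
  | zero => simp
  | add _ _ h1 h2 => simp only [map_add, add_tmul, tmul_add] at h1 h2 ⊢; rw [h1, h2]
  | tmul h p =>
  induction b using TensorProduct.induction_on with
  | zero => simp
  | add _ _ h1 h2 => simp only [map_add, add_tmul, tmul_add, add_mul] at h1 h2 ⊢; rw [h1, h2]
  | tmul g s =>
  induction c using TensorProduct.induction_on with
  | zero => simp
  | add _ _ h1 h2 => simp only [map_add, tmul_add, mul_add] at h1 h2 ⊢; rw [h1, h2]
  | tmul f l =>
    simp [coreMap_tmul, sandwich, Algebra.TensorProduct.one_def, kactLinP, sactLinP, mul_assoc]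

end helpers

theorem tensor_over_S_is_object_of_category
    (R : H ⊗[k] H) (hR : IsUnit R)
    (hR1 : (TensorProduct.map (Coalgebra.comul (R := k)) (LinearMap.id (M := H))) R =
      (Algebra.TensorProduct.map
          (Algebra.TensorProduct.includeLeft : H →ₐ[k] H ⊗[k] H) (AlgHom.id k H)) R *
      (Algebra.TensorProduct.map
          (Algebra.TensorProduct.includeRight : H →ₐ[k] H ⊗[k] H) (AlgHom.id k H)) R)
    (hR2 : (TensorProduct.map (LinearMap.id (M := H)) (Coalgebra.comul (R := k))) R =
      (TensorProduct.assoc k H H H)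
        ((Algebra.TensorProduct.map
            (Algebra.TensorProduct.includeLeft : H →ₐ[k] H ⊗[k] H) (AlgHom.id k H)) R *
         (Algebra.TensorProduct.includeLeft : (H ⊗[k] H) →ₐ[k] (H ⊗[k] H) ⊗[k] H) R))
    (hR3 : ∀ h : H, R * Coalgebra.comul (R := k) h =
      (TensorProduct.comm k H H) (Coalgebra.comul (R := k) h) * R)
    -- lamS, lamK are left H-comodule algebra structures
    (hcoassocS : (LinearMap.lTensor H lamS) ∘ₗ lamS =
      (TensorProduct.assoc k H H S).toLinearMap ∘ₗ
        (LinearMap.rTensor S (Coalgebra.comul (R := k))) ∘ₗ lamS)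
    (hcounitS : (TensorProduct.lid k S).toLinearMap ∘ₗ
        (LinearMap.rTensor S (Coalgebra.counit (R := k))) ∘ₗ lamS = LinearMap.id)
    (hmulS : ∀ a b : S, lamS (a * b) = lamS a * lamS b) (honeS : lamS 1 = 1)
    (hcoassocK : (LinearMap.lTensor H lamK) ∘ₗ lamK =
      (TensorProduct.assoc k H H K).toLinearMap ∘ₗ
        (LinearMap.rTensor K (Coalgebra.comul (R := k))) ∘ₗ lamK)
    (hcounitK : (TensorProduct.lid k K).toLinearMap ∘ₗ
        (LinearMap.rTensor K (Coalgebra.counit (R := k))) ∘ₗ lamK = LinearMap.id)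
    (hmulK : ∀ a b : K, lamK (a * b) = lamK a * lamK b) (honeK : lamK 1 = 1)
    -- P ∈ _K^H M_S : lamP is a comodule structure which is a morphism of (K,S)-bimodules
    (lamP : P →ₗ[k] H ⊗[k] P)
    (hcoassocP : (LinearMap.lTensor H lamP) ∘ₗ lamP =
      (TensorProduct.assoc k H H P).toLinearMap ∘ₗ
        (LinearMap.rTensor P (Coalgebra.comul (R := k))) ∘ₗ lamP)
    (hcounitP : (TensorProduct.lid k P).toLinearMap ∘ₗ
        (LinearMap.rTensor P (Coalgebra.counit (R := k))) ∘ₗ lamP = LinearMap.id)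
    (hbimodP : ∀ (r : K) (s : S),
      lamP ∘ₗ (DistribMulAction.toLinearMap k P r) ∘ₗ
          (DistribMulAction.toLinearMap k P (MulOpposite.op s)) =
        (sandwich k H S K P (kactLinP k K P) (sactLinP k S P)) ∘ₗ
          (TensorProduct.mk k (H ⊗[k] K) ((H ⊗[k] P) ⊗[k] (H ⊗[k] S)) (lamK r)) ∘ₗ
          ((TensorProduct.mk k (H ⊗[k] P) (H ⊗[k] S)).flip (lamS s)) ∘ₗ lamP)
    (X : Type) [AddCommGroup X] [Module k X] [Module H X] [FiniteDimensional k X]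
    [IsScalarTower k H X] [SMulCommClass H k X] [SMulCommClass k H X] :
    -- (a) X ⊗ S is a left S-module
    ((∀ s t : S, leftActXS k H S lamS X (s * t) =
        leftActXS k H S lamS X s ∘ₗ leftActXS k H S lamS X t) ∧
      leftActXS k H S lamS X 1 = LinearMap.id) ∧
    -- (b) the structure maps descend to P ⊗_S (X ⊗ S) and make it an object of _K^H M_S.
    -- N is the balancing submodule defining P ⊗_S (X ⊗ S):
    (∀ N : Submodule k (P ⊗[k] (X ⊗[k] S)),
      N = Submodule.span k {w : P ⊗[k] (X ⊗[k] S) |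
        ∃ (p : P) (s : S) (v : X ⊗[k] S),
          w = (MulOpposite.op s • p) ⊗ₜ v - p ⊗ₜ (leftActXS k H S lamS X s v)} →
      -- δ descends to the quotient
      (∀ w ∈ N, deltaW k H S lamS P R lamP X w ∈
        LinearMap.range (LinearMap.lTensor H N.subtype)) ∧
      -- the K-action and the right S-action descend to the quotient
      (∀ (r : K), ∀ w ∈ N,
        (LinearMap.rTensor (X ⊗[k] S) (DistribMulAction.toLinearMap k P r)) w ∈ N) ∧
      (∀ (l : S), ∀ w ∈ N,
        (LinearMap.lTensor P (LinearMap.lTensor X ((LinearMap.mul k S).flip l))) w ∈ N) ∧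
      -- δ is coassociative and counital modulo N
      (∀ w : P ⊗[k] (X ⊗[k] S), ∃ u : H ⊗[k] (H ⊗[k] N),
        (LinearMap.lTensor H (deltaW k H S lamS P R lamP X))
            (deltaW k H S lamS P R lamP X w) =
          (TensorProduct.assoc k H H (P ⊗[k] (X ⊗[k] S)))
            ((LinearMap.rTensor (P ⊗[k] (X ⊗[k] S)) (Coalgebra.comul (R := k)))
              (deltaW k H S lamS P R lamP X w)) +
          (LinearMap.lTensor H (LinearMap.lTensor H N.subtype)) u) ∧
      (∀ w : P ⊗[k] (X ⊗[k] S),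
        (TensorProduct.lid k (P ⊗[k] (X ⊗[k] S)))
            ((LinearMap.rTensor (P ⊗[k] (X ⊗[k] S)) (Coalgebra.counit (R := k)))
              (deltaW k H S lamS P R lamP X w)) - w ∈ N) ∧
      -- δ is a morphism of (K,S)-bimodules modulo N
      (∀ (r : K) (l : S) (w : P ⊗[k] (X ⊗[k] S)),
        deltaW k H S lamS P R lamP X
            ((LinearMap.rTensor (X ⊗[k] S) (DistribMulAction.toLinearMap k P r))
              ((LinearMap.lTensor P (LinearMap.lTensor X ((LinearMap.mul k S).flip l))) w)) -
          ((sandwich k H S K (P ⊗[k] (X ⊗[k] S))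
              ((LinearMap.rTensorHom (M := X ⊗[k] S)) ∘ₗ
                (Algebra.lsmul k k P : K →ₐ[k] Module.End k P).toLinearMap)
              ((LinearMap.lTensorHom (M := P)) ∘ₗ (LinearMap.lTensorHom (M := X)) ∘ₗ
                (LinearMap.mul k S).flip)) ∘ₗ
            (TensorProduct.mk k (H ⊗[k] K) _ (lamK r)) ∘ₗ
            ((TensorProduct.mk k (H ⊗[k] (P ⊗[k] (X ⊗[k] S))) (H ⊗[k] S)).flip (lamS l)) ∘ₗ
            (deltaW k H S lamS P R lamP X)) w ∈
        LinearMap.range (LinearMap.lTensor H N.subtype))) := by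
  have htK : ∀ (r : K) (p : P), DistribMulAction.toLinearMap k P r p = r • p := fun _ _ => rfl
  have htS : ∀ (s : Sᵐᵒᵖ) (p : P), DistribMulAction.toLinearMap k P s p = s • p := fun _ _ => rfl
  have hmkQ : ∀ (N : Submodule k (P ⊗[k] (X ⊗[k] S))) (z : H ⊗[k] (P ⊗[k] (X ⊗[k] S))),
      z ∈ LinearMap.range (LinearMap.lTensor H N.subtype) ↔ LinearMap.lTensor H N.mkQ z = 0 := by
    intro N z
    have hex : Function.Exact N.subtype N.mkQ := by
      rw [LinearMap.exact_iff]; simp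
    exact (lTensor_exact H hex (Submodule.mkQ_surjective N) z).symm
  have hPS : ∀ (p : P) (s : S), lamP (MulOpposite.op s • p) =
      mPMap k H S P (lamP p ⊗ₜ lamS s) := by
    intro p s
    have h := LinearMap.congr_fun (hbimodP 1 s) p
    rw [← sandwich_one_left k H S K P (lamP p) (lamS s), ← honeK]
    simpa [htK, htS] using h
  have hPK : ∀ (p : P) (r : K), lamP (r • p) =
      sandwich k H S K P (kactLinP k K P) (sactLinP k S P)
        (lamK r ⊗ₜ (lamP p ⊗ₜ (1 : H ⊗[k] S))) := by
    intro p r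
    have h := LinearMap.congr_fun (hbimodP r 1) p
    rw [← honeS]
    simpa [htK, htS] using h
  refine ⟨⟨?_, ?_⟩, ?_⟩
  · intro s t
    ext1 
    refine LinearMap.ext fun x => LinearMap.ext fun u => ?_
    change leftActXS k H S lamS X (s * t) (x ⊗ₜ u) =
      leftActXS k H S lamS X s (leftActXS k H S lamS X t (x ⊗ₜ u))
    simp only [leftAct_eq, hmulS, LMap_mul]
  · refine LinearMap.ext fun v => ?_
    rw [leftAct_eq, honeS, LMap_one, LinearMap.id_apply]
  intro N hNdef
  have hN : ∀ (p : P) (s : S) (v : X ⊗[k] S),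
      (MulOpposite.op s • p) ⊗ₜ v - p ⊗ₜ (leftActXS k H S lamS X s v) ∈ N := by
    intro p s v
    rw [hNdef]
    exact Submodule.subset_span ⟨p, s, v, rfl⟩
  refine ⟨?_, ?_, ?_, ?_, ?_, ?_⟩
  · intro w hw
    rw [hmkQ]
    have hle : N ≤ LinearMap.ker (LinearMap.lTensor H N.mkQ ∘ₗ deltaW k H S lamS P R lamP X) := by
      conv_lhs => rw [hNdef]
      rw [Submodule.span_le]
      rintro _ ⟨p, s, v, rfl⟩
      simp only [SetLike.mem_coe, LinearMap.mem_ker, LinearMap.comp_apply, map_sub, sub_eq_zero]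
      induction v using TensorProduct.induction_on with
      | zero => simp
      | add _ _ h1 h2 => simp only [map_add, tmul_add, h1, h2]
      | tmul x t =>
        rw [leftAct_eq, delta_leftAct k H S lamS P X hmulS, deltaW_eq, hPS,
          delta_rightAct k H S lamS P X N hN]
        have hc := LinearMap.congr_fun hcoassocS s
        simp only [LinearMap.comp_apply, LinearEquiv.coe_coe] at hc
        rw [hc, ZMap_swap k H S P X R hR3]
    exact hle hw
  · intro r w hw
    have hle : N ≤ N.comap (LinearMap.rTensor (X ⊗[k] S) (DistribMulAction.toLinearMap k P r)) := by
      conv_lhs => rw [hNdef]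
      rw [Submodule.span_le]
      rintro _ ⟨p, s, v, rfl⟩
      have h := hN (r • p) s v
      rw [← smul_comm] at h
      simpa [htK, htS] using h
    exact hle hw
  · intro l w hw
    have hle : N ≤ N.comap (LinearMap.lTensor P (LinearMap.lTensor X ((LinearMap.mul k S).flip l))) := by
      conv_lhs => rw [hNdef]
      rw [Submodule.span_le]
      rintro _ ⟨p, s, v, rfl⟩
      have h := hN p s (LinearMap.lTensor X ((LinearMap.mul k S).flip l) v)
      rw [leftAct_eq, ← LMap_right] at h
      simp only [SetLike.mem_coe, Submodule.mem_comap, map_sub, LinearMap.lTensor_tmul, leftAct_eq]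
      exact h
    exact hle hw
  · intro w
    refine ⟨0, ?_⟩
    rw [map_zero, add_zero]
    induction w using TensorProduct.induction_on with
    | zero => simp
    | add _ _ h1 h2 => simp only [map_add, h1, h2]
    | tmul p v =>
    induction v using TensorProduct.induction_on with
    | zero => simp
    | add _ _ h1 h2 => simp only [map_add, tmul_add, h1, h2]
    | tmul x s =>
      have hc := LinearMap.congr_fun hcoassocS s
      have hp := LinearMap.congr_fun hcoassocP p
      simp only [LinearMap.comp_apply, LinearEquiv.coe_coe] at hc hp
      have hnat := coreMap_natural k H S P X H (H ⊗[k] H) (Bialgebra.comulAlgHom k H) R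
        (lamP p) x (lamS s)
      rw [deltaW_eq, coreMap_iter, hc, hp, ← hR2, LinearEquiv.symm_apply_apply,
        LinearEquiv.symm_apply_apply]
      exact congrArg _ hnat.symm
  · intro w
    suffices h : (TensorProduct.lid k (P ⊗[k] (X ⊗[k] S)))
            ((LinearMap.rTensor (P ⊗[k] (X ⊗[k] S)) (Coalgebra.counit (R := k)))
              (deltaW k H S lamS P R lamP X w)) = w by
      rw [h, sub_self]; exact N.zero_mem
    induction w using TensorProduct.induction_on with
    | zero => simp
    | add _ _ h1 h2 => simp only [map_add, h1, h2]
    | tmul p v =>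
    induction v using TensorProduct.induction_on with
    | zero => simp
    | add _ _ h1 h2 => simp only [map_add, tmul_add, h1, h2]
    | tmul x s =>
      have hc := LinearMap.congr_fun hcounitS s
      have hp := LinearMap.congr_fun hcounitP p
      simp only [LinearMap.comp_apply, LinearEquiv.coe_coe, LinearMap.id_apply] at hc hp
      rw [← LinearEquiv.eq_symm_apply, TensorProduct.lid_symm_apply] at hc hp
      have hnat := coreMap_natural k H S P X H k (Bialgebra.counitAlgHom k H) R
        (lamP p) x (lamS s)
      have hcu := counit_R k H R hR hR2
      rw [deltaW_eq]
      refine (congrArg _ hnat).trans ?_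
      change TensorProduct.lid k _ (coreMap k H S k P X
        (LinearMap.lTensor H (Coalgebra.counit (R := k)) R ⊗ₜ
      (LinearMap.rTensor P (Coalgebra.counit (R := k)) (lamP p) ⊗ₜ
        (x ⊗ₜ LinearMap.rTensor S (Coalgebra.counit (R := k)) (lamS s))))) = _
      rw [hcu, hc, hp, coreMap_tmul]
      simp
  · intro r l w
    rw [hmkQ, map_sub, sub_eq_zero]
    congr 1
    induction w using TensorProduct.induction_on with
    | zero => simp
    | add _ _ h1 h2 => simp only [map_add, h1, h2]
    | tmul p v =>
    induction v using TensorProduct.induction_on with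
    | zero => simp
    | add _ _ h1 h2 => simp only [map_add, tmul_add, h1, h2]
    | tmul x s =>
      simp only [LinearMap.lTensor_tmul, LinearMap.rTensor_tmul, LinearMap.flip_apply,
        LinearMap.mul_apply', htK, LinearMap.comp_apply,
        TensorProduct.mk_apply]
      rw [deltaW_eq, deltaW_eq, hPK, hmulS, coreMap_bimod]
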